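/- Let Γ be a countable discrete group whose amenable radical Rad(Γ) is trivial. Then every Γ-invariant von Neumann subalgebra M ⊆ L(Γ) is a factor, i.e. its center Z(M) = M ∩ M' consists only of scalar multiples of the identity. -/

import Mathlib

open scoped InnerProductSpace ComplexOrder ENNReal
open ContinuousLinearMap

noncomputable section

/-- A group `G` is amenable if there is a left-translation-invariant state (invariant mean)
on the algebra `ℓ^∞(G)` of bounded complex functions on `G`. -/
def HasInvariantMean (G : Type*) [Group G] : Prop :=
  ∃ m : lp (fun _ : G => ℂ) ∞ →ₗ[ℂ] ℂ,
    m 1 = 1 ∧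
    (∀ f : lp (fun _ : G => ℂ) ∞, 0 ≤ m (star f * f)) ∧
    ∀ (g : G) (f₁ f₂ : lp (fun _ : G => ℂ) ∞), (∀ x : G, f₂ x = f₁ (g * x)) → m f₂ = m f₁

variable {Γ : Type*} [Group Γ] [Countable Γ]
variable {H : Type*} [NormedAddCommGroup H] [InnerProductSpace ℂ H] [CompleteSpace H]

/-- A state on `B(H)`: a positive linear functional taking the value `1` at the unit. -/
def IsStateB (φ : (H →L[ℂ] H) →ₗ[ℂ] ℂ) : Prop :=
  φ 1 = 1 ∧ ∀ T : H →L[ℂ] H, 0 ≤ φ (adjoint T * T)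

/-- The group von Neumann algebra `L(Γ)`: the double commutant of the range of the left
regular representation `lam`. -/
def groupVN (lam : Γ → H →L[ℂ] H) : Set (H →L[ℂ] H) :=
  Set.centralizer (Set.centralizer (Set.range lam))

/-- For a subgroup `K ≤ Γ`, the von Neumann subalgebra `L(K)` of `L(Γ)` generated by
`{lam h : h ∈ K}`, realized as the double commutant. -/
def subgroupVN (lam : Γ → H →L[ℂ] H) (K : Subgroup Γ) : Set (H →L[ℂ] H) :=
  Set.centralizer (Set.centralizer (lam '' (K : Set Γ)))

/-- The canonical trace `τ₀(x) = ⟨x δ_e, δ_e⟩` on `L(Γ)`, where `δ_e = b 1`. -/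
def tau0 (b : HilbertBasis Γ ℂ H) : (H →L[ℂ] H) → ℂ :=
  fun x => ⟪(b 1 : H), x (b 1)⟫_ℂ

/-- An `(M, τ₀)`-hypertrace: a state `φ` on `B(ℓ²(Γ))` with `φ|_{L(Γ)} = τ₀` and
`φ(mT) = φ(Tm)` for all `m ∈ M`, `T ∈ B(ℓ²(Γ))`. -/
def IsHypertrace (b : HilbertBasis Γ ℂ H) (lam : Γ → H →L[ℂ] H)
    (M : Set (H →L[ℂ] H)) (φ : (H →L[ℂ] H) →ₗ[ℂ] ℂ) : Prop :=
  IsStateB φ ∧ (∀ x ∈ groupVN lam, φ x = tau0 b x) ∧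
    ∀ m ∈ M, ∀ T : H →L[ℂ] H, φ (m * T) = φ (T * m)

open Filter Topology Set

section FixedPoints

variable {E : Type*} [AddCommGroup E] [Module ℝ E] [TopologicalSpace E]
  [IsTopologicalAddGroup E] [ContinuousSMul ℝ E] [T2Space E]

/-- A continuous linear map preserving a nonempty compact convex set has a fixed point in it. -/
lemma exists_fixedPoint_of_mapsTo {K : Set E} (hK : IsCompact K) (hconv : Convex ℝ K)
    (hne : K.Nonempty) (T : E →L[ℝ] E) (hT : MapsTo T K K) : ∃ x ∈ K, T x = x := by
  obtain ⟨x₀, hx₀⟩ := hne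
  have hiter : ∀ n : ℕ, (T ^ n) x₀ ∈ K := by
    intro n
    induction n with
    | zero => simpa using hx₀
    | succ n ih => rw [pow_succ']; exact hT ih
  set y : ℕ → E := fun n => ((n : ℝ) + 1)⁻¹ • ∑ k ∈ Finset.range (n + 1), (T ^ k) x₀ with hy
  have hyK : ∀ n, y n ∈ K := by
    intro n
    have hpos : (0 : ℝ) < (n : ℝ) + 1 := by positivity
    rw [hy]
    simp only [Finset.smul_sum]
    refine hconv.sum_mem (fun _ _ => by positivity) ?_ (fun k _ => hiter k)
    simp [hpos.ne']
  set U : Ultrafilter ℕ := Ultrafilter.of atTop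
  have hU : (U : Filter ℕ) ≤ atTop := Ultrafilter.of_le atTop
  obtain ⟨x, hxK, hx⟩ := hK.ultrafilter_le_nhds (U.map y) (by
    rw [le_principal_iff]
    exact Filter.Eventually.of_forall (f := (U : Filter ℕ)) hyK)
  have hlim : Tendsto y U (𝓝 x) := hx
  refine ⟨x, hxK, ?_⟩
  have hzero : Tendsto (fun n : ℕ => ((n : ℝ) + 1)⁻¹) U (𝓝 0) :=
    (tendsto_inv_atTop_zero.comp
      (tendsto_atTop_add_const_right _ 1 tendsto_natCast_atTop_atTop)).mono_left hU
  have hbdd := hK.isVonNBounded ℝ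
  have h1 : Tendsto (fun n : ℕ => ((n : ℝ) + 1)⁻¹ • (T ^ (n + 1)) x₀) U (𝓝 0) :=
    hbdd.smul_tendsto_zero (Eventually.of_forall fun n => hiter (n + 1)) hzero
  have h2 : Tendsto (fun n : ℕ => ((n : ℝ) + 1)⁻¹ • x₀) U (𝓝 0) :=
    hbdd.smul_tendsto_zero (Eventually.of_forall fun _ => hx₀) hzero
  have hdiff : ∀ n, T (y n) - y n
      = ((n : ℝ) + 1)⁻¹ • (T ^ (n + 1)) x₀ - ((n : ℝ) + 1)⁻¹ • x₀ := by
    intro n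
    have hTs : ∀ k, T ((T ^ k) x₀) = (T ^ (k + 1)) x₀ := fun k => by rw [pow_succ']; rfl
    simp only [hy, map_smul, map_sum, hTs, ← smul_sub]
    congr 1
    rw [← Finset.sum_sub_distrib, Finset.sum_range_sub (fun k => (T ^ k) x₀)]
    simp
  have h3 : Tendsto (fun n => T (y n) - y n) U (𝓝 (T x - x)) :=
    ((T.continuous.tendsto x).comp hlim).sub hlim
  have h4 : Tendsto (fun n => T (y n) - y n) U (𝓝 0) := by
    simp only [hdiff]
    simpa using h1.sub h2
  exact sub_eq_zero.mp (tendsto_nhds_unique h3 h4)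

lemma isCompact_inter_fixedPoints {E : Type*} [AddCommGroup E] [Module ℝ E] [TopologicalSpace E]
    [T2Space E] {K : Set E} (hK : IsCompact K) (T : E →L[ℝ] E) :
    IsCompact (K ∩ {x | T x = x}) :=
  hK.inter_right (isClosed_eq T.continuous continuous_id)

lemma convex_inter_fixedPoints {E : Type*} [AddCommGroup E] [Module ℝ E] [TopologicalSpace E]
    {K : Set E} (hK : Convex ℝ K) (T : E →L[ℝ] E) :
    Convex ℝ (K ∩ {x | T x = x}) := by
  refine hK.inter ?_
  intro x hx y hy a b _ _ _
  simp only [mem_ofPred_eq] at hx hy ⊢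
  simp [hx, hy]

/-- The **Markov–Kakutani theorem** for a commuting family of continuous linear maps. -/
theorem exists_common_fixedPoint {K : Set E} (hK : IsCompact K) (hconv : Convex ℝ K)
    (hne : K.Nonempty) (𝒯 : Set (E →L[ℝ] E)) (hmaps : ∀ T ∈ 𝒯, MapsTo T K K)
    (hcomm : ∀ S ∈ 𝒯, ∀ T ∈ 𝒯, ∀ x, S (T x) = T (S x)) :
    ∃ x ∈ K, ∀ T ∈ 𝒯, T x = x := by
  classical
  have key : ∀ s : Finset 𝒯, ∀ K : Set E, IsCompact K → Convex ℝ K → K.Nonempty →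
      (∀ T ∈ 𝒯, MapsTo T K K) → (K ∩ ⋂ T ∈ s, {x | (T : E →L[ℝ] E) x = x}).Nonempty := by
    intro s
    induction s using Finset.induction_on with
    | empty => intro K _ _ h _; simpa using h
    | insert T s _ ih =>
      intro K hK hconv hne hmaps
      obtain ⟨x, hxK, hx⟩ := exists_fixedPoint_of_mapsTo hK hconv hne T (hmaps T T.2)
      obtain ⟨z, ⟨hzK, hzT⟩, hz⟩ := ih (K ∩ {x | (T : E →L[ℝ] E) x = x})
        (isCompact_inter_fixedPoints hK T) (convex_inter_fixedPoints hconv T) ⟨x, hxK, hx⟩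
        (fun S hS w hw => ⟨hmaps S hS hw.1, by
          have h := hw.2
          simp only [mem_ofPred_eq] at h ⊢
          rw [hcomm T T.2 S hS, h]⟩)
      refine ⟨z, hzK, ?_⟩
      simp only [Finset.mem_insert, iInter_iInter_eq_or_left]
      exact ⟨hzT, hz⟩
  obtain ⟨x, hxK, hx⟩ := hK.inter_iInter_nonempty (fun T : 𝒯 => {x | (T : E →L[ℝ] E) x = x})
    (fun T => isClosed_eq (T : E →L[ℝ] E).continuous continuous_id)
    (fun s => key s K hK hconv hne hmaps)
  exact ⟨x, hxK, fun T hT => by simpa using mem_iInter.mp hx ⟨T, hT⟩⟩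

/-- A nonempty compact convex set preserved by a family of maps contains a minimal such set. -/
lemma exists_minimal_invariant_convex {E : Type*} [AddCommGroup E] [Module ℝ E]
    [TopologicalSpace E] [T2Space E] {K : Set E} (hK : IsCompact K) (hconv : Convex ℝ K)
    (hne : K.Nonempty) {ι : Type*} (T : ι → E → E) (hT : ∀ i, MapsTo (T i) K K) :
    ∃ C ⊆ K, IsCompact C ∧ Convex ℝ C ∧ C.Nonempty ∧ (∀ i, MapsTo (T i) C C) ∧
      ∀ D ⊆ C, IsCompact D → Convex ℝ D → D.Nonempty → (∀ i, MapsTo (T i) D D) → D = C := by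
  obtain ⟨C, hCK, ⟨⟨hC, hCconv, hCne, hCT⟩, hmin⟩⟩ := zorn_superset_nonempty
    {C : Set E | IsCompact C ∧ Convex ℝ C ∧ C.Nonempty ∧ ∀ i, MapsTo (T i) C C} (by
      intro c hc hchain hcne
      have : Nonempty c := hcne.to_subtype
      refine ⟨⋂₀ c, ⟨?_, ?_, ?_, ?_⟩, fun s hs => sInter_subset_of_mem hs⟩
      · obtain ⟨s, hs⟩ := hcne
        exact (hc hs).1.of_isClosed_subset
          (isClosed_sInter fun t ht => (hc ht).1.isClosed) (sInter_subset_of_mem hs)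
      · exact convex_sInter fun s hs => (hc hs).2.1
      · exact IsCompact.nonempty_sInter_of_directed_nonempty_isCompact_isClosed
          (fun s hs t ht => (hchain.total hs ht).elim
            (fun h => ⟨s, hs, Subset.rfl, h⟩) (fun h => ⟨t, ht, h, Subset.rfl⟩))
          (fun s hs => (hc hs).2.2.1) (fun s hs => (hc hs).1)
          (fun s hs => (hc hs).1.isClosed)
      · intro i x hx s hs
        exact (hc hs).2.2.2 i (hx s hs)) K ⟨hK, hconv, hne, hT⟩
  exact ⟨C, hCK, hC, hCconv, hCne, hCT, fun D hD h1 h2 h3 h4 =>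
    hD.antisymm (hmin ⟨h1, h2, h3, h4⟩ hD)⟩

end FixedPoints

section Means

variable {G : Type*} [Group G]

/-- The real algebra `ℓ^∞(G, ℝ)` of bounded real functions on `G`. -/
abbrev BoundedReal (G : Type*) : Type _ := lp (fun _ : G => ℝ) ∞

/-- A bounded function as an element of `ℓ^∞(G, ℝ)`. -/
def BoundedReal.ofBound {G : Type*} (f : G → ℝ) (c : ℝ) (h : ∀ t, |f t| ≤ c) : BoundedReal G :=
  ⟨f, memℓp_infty ⟨c, by rintro _ ⟨t, rfl⟩; exact h t⟩⟩

lemma BoundedReal.abs_apply_le {G : Type*} (f : BoundedReal G) (t : G) : |f t| ≤ ‖f‖ :=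
  lp.norm_apply_le_norm ENNReal.top_ne_zero f t

lemma BoundedReal.smul_apply {G : Type*} (c : ℝ) (f : BoundedReal G) (t : G) :
    (c • f) t = c * f t := rfl

lemma BoundedReal.add_apply {G : Type*} (f h : BoundedReal G) (t : G) :
    (f + h) t = f t + h t := rfl

lemma BoundedReal.sub_apply {G : Type*} (f h : BoundedReal G) (t : G) :
    (f - h) t = f t - h t := rfl

lemma BoundedReal.mul_apply {G : Type*} (f h : BoundedReal G) (t : G) :
    (f * h) t = f t * h t := rfl

lemma BoundedReal.one_apply {G : Type*} (t : G) : (1 : BoundedReal G) t = 1 := rfl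

/-- Left translation on `ℓ^∞(G, ℝ)`. -/
def leftTranslate (g : G) (f : BoundedReal G) : BoundedReal G :=
  BoundedReal.ofBound (fun t => f (g⁻¹ * t)) ‖f‖ fun t => BoundedReal.abs_apply_le f (g⁻¹ * t)

lemma leftTranslate_apply (g : G) (f : BoundedReal G) (t : G) :
    leftTranslate g f t = f (g⁻¹ * t) := rfl

lemma leftTranslate_mul (g h : G) (f : BoundedReal G) :
    leftTranslate (g * h) f = leftTranslate g (leftTranslate h f) := by
  ext t; simp [leftTranslate_apply, mul_assoc]

lemma leftTranslate_one (f : BoundedReal G) : leftTranslate 1 f = f := by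
  ext t; simp [leftTranslate_apply]

/-- A mean on `G`: a normalized positive linear functional on `ℓ^∞(G, ℝ)`. -/
structure IsMean {G : Type*} (ω : BoundedReal G → ℝ) : Prop where
  add : ∀ f h, ω (f + h) = ω f + ω h
  smul : ∀ (c : ℝ) f, ω (c • f) = c * ω f
  one : ω 1 = 1
  nonneg : ∀ f, (∀ t, 0 ≤ f t) → 0 ≤ ω f

namespace IsMean

variable {ω : BoundedReal G → ℝ}

lemma sub {G : Type*} {ω : BoundedReal G → ℝ} (hω : IsMean ω) (f h : BoundedReal G) :
    ω (f - h) = ω f - ω h := by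
  have := hω.add (f - h) h
  rw [sub_add_cancel] at this
  linarith

lemma le_of_le {G : Type*} {ω : BoundedReal G → ℝ} (hω : IsMean ω) {f : BoundedReal G} {c : ℝ}
    (h : ∀ t, f t ≤ c) : ω f ≤ c := by
  have h1 := hω.nonneg (c • 1 - f) fun t => by
    simpa [BoundedReal.sub_apply, BoundedReal.smul_apply, BoundedReal.one_apply] using h t
  rw [hω.sub, hω.smul, hω.one] at h1
  linarith

lemma ge_of_ge {G : Type*} {ω : BoundedReal G → ℝ} (hω : IsMean ω) {f : BoundedReal G} {c : ℝ}
    (h : ∀ t, c ≤ f t) : c ≤ ω f := by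
  have h1 := hω.nonneg (f - c • 1) fun t => by
    simpa [BoundedReal.sub_apply, BoundedReal.smul_apply, BoundedReal.one_apply] using h t
  rw [hω.sub, hω.smul, hω.one] at h1
  linarith

lemma abs_le {G : Type*} {ω : BoundedReal G → ℝ} (hω : IsMean ω) (f : BoundedReal G) :
    |ω f| ≤ ‖f‖ :=
  _root_.abs_le.mpr ⟨hω.ge_of_ge fun t => (_root_.abs_le.mp (BoundedReal.abs_apply_le f t)).1,
    hω.le_of_le fun t => (_root_.abs_le.mp (BoundedReal.abs_apply_le f t)).2⟩

lemma comp_leftTranslate (hω : IsMean ω) (g : G) : IsMean fun f => ω (leftTranslate g f) where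
  add f h := hω.add (leftTranslate g f) (leftTranslate g h)
  smul c f := hω.smul c (leftTranslate g f)
  one := hω.one
  nonneg _ hf := hω.nonneg _ fun _ => hf _

lemma eval {G : Type*} (t : G) : IsMean fun f : BoundedReal G => f t where
  add _ _ := rfl
  smul _ _ := rfl
  one := rfl
  nonneg _ hf := hf t

end IsMean

lemma isClosed_setOf_isMean (G : Type*) : IsClosed {ω : BoundedReal G → ℝ | IsMean ω} := by
  have : {ω : BoundedReal G → ℝ | IsMean ω} =
      (⋂ (f : BoundedReal G) (h : BoundedReal G), {ω | ω (f + h) = ω f + ω h}) ∩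
      (⋂ (c : ℝ) (f : BoundedReal G), {ω | ω (c • f) = c * ω f}) ∩ {ω | ω 1 = 1} ∩
      ⋂ (f : BoundedReal G) (_ : ∀ t, 0 ≤ f t), {ω | 0 ≤ ω f} := by
    ext ω
    simp only [mem_inter_iff, mem_iInter, mem_ofPred_eq]
    exact ⟨fun h => ⟨⟨⟨h.1, h.2⟩, h.3⟩, h.4⟩, fun h => ⟨h.1.1.1, h.1.1.2, h.1.2, h.2⟩⟩
  rw [this]
  refine ((IsClosed.inter ?_ ?_).inter ?_).inter ?_
  · exact isClosed_iInter fun _ => isClosed_iInter fun _ =>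
      isClosed_eq (continuous_apply _) (by fun_prop)
  · exact isClosed_iInter fun c => isClosed_iInter fun f =>
      isClosed_eq (continuous_apply _) (continuous_const.mul (continuous_apply _))
  · exact isClosed_eq (continuous_apply _) continuous_const
  · exact isClosed_iInter fun _ => isClosed_iInter fun _ =>
      isClosed_le continuous_const (continuous_apply _)

lemma isCompact_setOf_isMean (G : Type*) : IsCompact {ω : BoundedReal G → ℝ | IsMean ω} := by
  refine (isCompact_univ_pi fun f : BoundedReal G =>
    isCompact_Icc (a := -‖f‖) (b := ‖f‖)).of_isClosed_subset (isClosed_setOf_isMean G) ?_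
  intro ω hω f _
  exact abs_le.mp (IsMean.abs_le hω f)

lemma convex_setOf_isMean (G : Type*) : Convex ℝ {ω : BoundedReal G → ℝ | IsMean ω} := by
  intro ω hω ν hν a c ha hc hac
  exact
    { add := fun f h => by
        simp only [Pi.add_apply, Pi.smul_apply, smul_eq_mul, hω.add, hν.add]; ring
      smul := fun r f => by
        simp only [Pi.add_apply, Pi.smul_apply, smul_eq_mul, hω.smul, hν.smul]; ring
      one := by simp [hω.one, hν.one, hac]
      nonneg := fun f hf => by
        have h1 := hω.nonneg f hf
        have h2 := hν.nonneg f hf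
        simp only [Pi.add_apply, Pi.smul_apply, smul_eq_mul]
        positivity }

/-- On means, a continuous linear functional is evaluation at a bounded function. -/
lemma exists_eq_eval {G : Type*} (l : (BoundedReal G → ℝ) →L[ℝ] ℝ) :
    ∃ f : BoundedReal G, ∀ ω, IsMean ω → l ω = ω f := by
  have hmem : (l : (BoundedReal G → ℝ) →ₗ[ℝ] ℝ) ∈ Submodule.span ℝ
      (range fun f : BoundedReal G => (LinearMap.proj f : (BoundedReal G → ℝ) →ₗ[ℝ] ℝ)) := by
    rw [LinearMap.mem_span_iff_continuous]
    exact l.continuous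
  have : ∀ l' ∈ Submodule.span ℝ
      (range fun f : BoundedReal G => (LinearMap.proj f : (BoundedReal G → ℝ) →ₗ[ℝ] ℝ)),
      ∃ f : BoundedReal G, ∀ ω, IsMean ω → l' ω = ω f := by
    intro l' hl'
    induction hl' using Submodule.span_induction with
    | mem x hx => obtain ⟨f, rfl⟩ := hx; exact ⟨f, fun ω _ => rfl⟩
    | zero => exact ⟨0, fun ω hω => by
        have := hω.smul 0 0
        simpa using this.symm⟩
    | add x y _ _ hx hy =>
      obtain ⟨f, hf⟩ := hx
      obtain ⟨h, hh⟩ := hy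
      exact ⟨f + h, fun ω hω => by simp [hf ω hω, hh ω hω, hω.add]⟩
    | smul c x _ hx =>
      obtain ⟨f, hf⟩ := hx
      exact ⟨c • f, fun ω hω => by simp [hf ω hω, hω.smul]⟩
  exact this _ hmem

/-- The Poisson transform of a bounded function with respect to a mean. -/
def poisson {ω : BoundedReal G → ℝ} (hω : IsMean ω) (f : BoundedReal G) : BoundedReal G :=
  BoundedReal.ofBound (fun t => ω (leftTranslate t⁻¹ f)) ‖f‖ fun t =>
    (hω.comp_leftTranslate t⁻¹).abs_le f

section Poisson

variable {ω₀ : BoundedReal G → ℝ} (hω₀ : IsMean ω₀)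

lemma poisson_apply (f : BoundedReal G) (t : G) :
    poisson hω₀ f t = ω₀ (leftTranslate t⁻¹ f) := rfl

lemma poisson_leftTranslate (g : G) (f : BoundedReal G) :
    poisson hω₀ (leftTranslate g f) = leftTranslate g (poisson hω₀ f) := by
  ext t
  simp [poisson_apply, leftTranslate_apply, ← leftTranslate_mul]

lemma IsMean.comp_poisson {ν : BoundedReal G → ℝ} (hν : IsMean ν) :
    IsMean fun f => ν (poisson hω₀ f) where
  add f h := by
    rw [← hν.add]; congr 1; ext t
    exact (hω₀.comp_leftTranslate t⁻¹).add f h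
  smul c f := by
    rw [← hν.smul]; congr 1; ext t
    exact (hω₀.comp_leftTranslate t⁻¹).smul c f
  one := by
    rw [← hν.one]; congr 1; ext t
    exact (hω₀.comp_leftTranslate t⁻¹).one
  nonneg f hf := hν.nonneg _ fun t => (hω₀.comp_leftTranslate t⁻¹).nonneg f hf

/-- The barycenter of a mean transported to the orbit of `ω₀` lies in every closed convex
invariant set of means containing `ω₀`. -/
lemma comp_poisson_mem {C : Set (BoundedReal G → ℝ)} (hC : IsClosed C) (hconv : Convex ℝ C)
    (hmean : ∀ ω ∈ C, IsMean ω) (hinv : ∀ ω ∈ C, ∀ g, (fun f => ω (leftTranslate g f)) ∈ C)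
    (h₀ : ω₀ ∈ C) {ν : BoundedReal G → ℝ} (hν : IsMean ν) :
    (fun f => ν (poisson hω₀ f)) ∈ C := by
  by_contra hnot
  obtain ⟨l, r, hl, hr⟩ := geometric_hahn_banach_closed_point hconv hC hnot
  obtain ⟨f, hf⟩ := exists_eq_eval l
  rw [hf _ (IsMean.comp_poisson hω₀ hν)] at hr
  have : ν (poisson hω₀ f) ≤ r := hν.le_of_le fun t => by
    have h1 := hl _ (hinv ω₀ h₀ t⁻¹)
    rw [hf _ (hmean _ (hinv ω₀ h₀ t⁻¹))] at h1
    exact h1.le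
  linarith

/-- A mean whose barycenter is an extreme point is multiplicative on Poisson transforms. -/
lemma mul_poisson_of_mem_extremePoints {C : Set (BoundedReal G → ℝ)} (hC : IsClosed C)
    (hconv : Convex ℝ C)
    (hmean : ∀ ω ∈ C, IsMean ω) (hinv : ∀ ω ∈ C, ∀ g, (fun f => ω (leftTranslate g f)) ∈ C)
    (h₀ : ω₀ ∈ C) {ω : BoundedReal G → ℝ} (hω : ω ∈ C.extremePoints ℝ)
    {ν : BoundedReal G → ℝ} (hν : IsMean ν) (hνω : ∀ f, ν (poisson hω₀ f) = ω f)
    (h f : BoundedReal G) : ν (h * poisson hω₀ f) = ν h * ω f := by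
  have hweight : ∀ k : BoundedReal G, (∀ t, 0 ≤ k t) → 0 < ν k →
      IsMean fun f => (ν k)⁻¹ * ν (k * f) := by
    intro k hk hpos
    refine ⟨fun f h => ?_, fun c f => ?_, ?_, fun f hf => ?_⟩
    · rw [mul_add, hν.add, mul_add]
    · rw [mul_smul_comm, hν.smul]; ring
    · rw [mul_one, inv_mul_cancel₀ hpos.ne']
    · exact mul_nonneg (inv_nonneg.mpr hpos.le) (hν.nonneg _ fun t => mul_nonneg (hk t) (hf t))
  have hsmall : ∀ h : BoundedReal G, (∀ t, |h t| ≤ 1 / 2) →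
      ν (h * poisson hω₀ f) = ν h * ω f := by
    intro h hh
    have hlow : -(1 / 2) ≤ ν h := hν.ge_of_ge fun t => (abs_le.mp (hh t)).1
    have hup : ν h ≤ 1 / 2 := hν.le_of_le fun t => (abs_le.mp (hh t)).2
    have e1 : ν (1 + h) = 1 + ν h := by rw [hν.add, hν.one]
    have e2 : ν (1 - h) = 1 - ν h := by rw [hν.sub, hν.one]
    have p1 : 0 < ν (1 + h) := by linarith
    have p2 : 0 < ν (1 - h) := by linarith
    have m1 := hweight (1 + h) (fun t => by
      have := (abs_le.mp (hh t)).1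
      rw [BoundedReal.add_apply, BoundedReal.one_apply]; linarith) p1
    have m2 := hweight (1 - h) (fun t => by
      have := (abs_le.mp (hh t)).2
      rw [BoundedReal.sub_apply, BoundedReal.one_apply]; linarith) p2
    have c1 := comp_poisson_mem hω₀ hC hconv hmean hinv h₀ m1
    have c2 := comp_poisson_mem hω₀ hC hconv hmean hinv h₀ m2
    have hext := (mem_extremePoints.mp hω).2 _ c1 _ c2
      ⟨ν (1 + h) / 2, ν (1 - h) / 2, by positivity, by positivity, by rw [e1, e2]; ring, by
        ext f'
        simp only [Pi.add_apply, Pi.smul_apply, smul_eq_mul]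
        rw [← hνω f']
        have : ν ((1 + h) * poisson hω₀ f') + ν ((1 - h) * poisson hω₀ f')
            = 2 * ν (poisson hω₀ f') := by
          rw [← hν.add, ← hν.smul]
          congr 1
          rw [two_smul]
          ring
        field_simp
        linarith⟩
    have h1 := congrFun hext.1 f
    rw [inv_mul_eq_iff_eq_mul₀ p1.ne', add_mul, one_mul, hν.add, hνω, e1] at h1
    linarith
  set c : ℝ := 2 * ‖h‖ + 1 with hc
  have hcpos : 0 < c := by positivity
  have := hsmall (c⁻¹ • h) fun t => by
    rw [BoundedReal.smul_apply, abs_mul, abs_inv, abs_of_pos hcpos, inv_mul_le_iff₀ hcpos]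
    have := BoundedReal.abs_apply_le h t
    linarith
  rw [smul_mul_assoc, hν.smul, hν.smul, mul_assoc] at this
  exact mul_left_cancel₀ (inv_pos.mpr hcpos).ne' this

end Poisson

end Means

section Operators

variable {G : Type*} {H : Type*} [NormedAddCommGroup H] [InnerProductSpace ℂ H]

lemma HilbertBasis.clm_ext (b : HilbertBasis G ℂ H) {S T : H →L[ℂ] H}
    (h : ∀ t, S (b t) = T (b t)) : S = T := by
  refine ContinuousLinearMap.ext_on (s := range b) ?_ (by rintro _ ⟨t, rfl⟩; exact h t)
  rw [dense_iff_closure_eq, ← Submodule.topologicalClosure_coe, b.dense_span]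
  rfl

/-- Pointwise multiplication by a bounded real function on `ℓ²(G)`. -/
def lpMul (f : BoundedReal G) : lp (fun _ : G => ℂ) 2 →ₗ[ℂ] lp (fun _ : G => ℂ) 2 where
  toFun ξ := ⟨fun t => (f t : ℂ) * ξ t, by
    refine memℓp_gen ?_
    have hs := (lp.memℓp ξ).summable (by norm_num)
    refine Summable.of_nonneg_of_le (fun t => by positivity) (fun t => ?_)
      (hs.mul_left (‖f‖ ^ (2 : ENNReal).toReal))
    rw [norm_mul, Real.mul_rpow (norm_nonneg _) (norm_nonneg _)]
    gcongr
    simpa using BoundedReal.abs_apply_le f t⟩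
  map_add' ξ η := by
    ext t
    exact mul_add _ _ _
  map_smul' c ξ := by
    ext t
    exact mul_left_comm _ _ _

lemma lpMul_apply (f : BoundedReal G) (ξ : lp (fun _ : G => ℂ) 2) (t : G) :
    lpMul f ξ t = (f t : ℂ) * ξ t := rfl

lemma lpMul_isSymmetric (f : BoundedReal G) : (lpMul f).IsSymmetric := by
  intro ξ η
  rw [lp.inner_eq_tsum, lp.inner_eq_tsum]
  congr 1
  ext t
  simp only [lpMul_apply, RCLike.inner_apply, map_mul, Complex.conj_ofReal]
  ring

/-- The diagonal operator with bounded real entries `f` in the Hilbert basis `b`. -/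
def diagOp (b : HilbertBasis G ℂ H) (f : BoundedReal G) : H →L[ℂ] H :=
  (b.repr.symm.toContinuousLinearEquiv : lp (fun _ : G => ℂ) 2 →L[ℂ] H) ∘L
    ⟨lpMul f, (lpMul_isSymmetric f).continuous⟩ ∘L
    (b.repr.toContinuousLinearEquiv : H →L[ℂ] lp (fun _ : G => ℂ) 2)

lemma repr_diagOp (b : HilbertBasis G ℂ H) (f : BoundedReal G) (x : H) (t : G) :
    b.repr (diagOp b f x) t = (f t : ℂ) * b.repr x t := by
  have : b.repr (diagOp b f x) = lpMul f (b.repr x) :=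
    b.repr.apply_symm_apply _
  rw [this, lpMul_apply]

lemma diagOp_basis (b : HilbertBasis G ℂ H) (f : BoundedReal G) (t : G) :
    diagOp b f (b t) = (f t : ℂ) • b t := by
  classical
  apply b.repr.injective
  ext s
  rw [repr_diagOp, map_smul, b.repr_self, lp.coeFn_smul, Pi.smul_apply]
  by_cases h : s = t
  · subst h; simp
  · simp [h]

lemma diagOp_add (b : HilbertBasis G ℂ H) (f h : BoundedReal G) :
    diagOp b (f + h) = diagOp b f + diagOp b h :=
  b.clm_ext fun t => by simp [diagOp_basis, BoundedReal.add_apply, add_smul]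

lemma diagOp_smul (b : HilbertBasis G ℂ H) (c : ℝ) (f : BoundedReal G) :
    diagOp b (c • f) = (c : ℂ) • diagOp b f :=
  b.clm_ext fun t => by simp [diagOp_basis, BoundedReal.smul_apply, mul_smul]

lemma diagOp_one (b : HilbertBasis G ℂ H) : diagOp b 1 = 1 :=
  b.clm_ext fun t => by simp [diagOp_basis, BoundedReal.one_apply]

lemma diagOp_mul (b : HilbertBasis G ℂ H) (f h : BoundedReal G) :
    diagOp b (f * h) = diagOp b f * diagOp b h :=
  b.clm_ext fun t => by
    rw [mul_apply_eq_comp, diagOp_basis, diagOp_basis, map_smul, diagOp_basis, smul_smul,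
      BoundedReal.mul_apply, Complex.ofReal_mul, mul_comm]

lemma star_diagOp [CompleteSpace H] (b : HilbertBasis G ℂ H) (f : BoundedReal G) :
    star (diagOp b f) = diagOp b f := by
  refine b.clm_ext fun t => b.repr.injective ?_
  classical
  ext s
  rw [b.repr_apply_apply, b.repr_apply_apply, ContinuousLinearMap.star_eq_adjoint,
    ContinuousLinearMap.adjoint_inner_right, diagOp_basis, diagOp_basis, inner_smul_left,
    inner_smul_right, orthonormal_iff_ite.mp b.orthonormal]
  by_cases h : s = t
  · subst h; simp
  · simp [h]

variable [Group G]

/-- Covariance of diagonal operators under left translation. -/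
lemma lam_mul_diagOp (b : HilbertBasis G ℂ H) (lam : G → H →L[ℂ] H)
    (hlam : ∀ g t : G, lam g (b t) = b (g * t)) (g : G) (f : BoundedReal G) :
    lam g * diagOp b f = diagOp b (leftTranslate g f) * lam g :=
  b.clm_ext fun t => by simp [diagOp_basis, hlam, leftTranslate_apply]

/-- The right regular representation in the Hilbert basis `b`. -/
lemma exists_right_translation [CompleteSpace H] (b : HilbertBasis G ℂ H) (g : G) :
    ∃ R : H →L[ℂ] H, ∀ t, R (b t) = b (t * g) := by
  have hinj : Function.Injective fun t : G => t * g := mul_left_injective g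
  have hrange : range (fun t : G => b (t * g)) = range b :=
    (Equiv.mulRight g).surjective.range_comp b
  have hdense : ⊤ ≤ (Submodule.span ℂ (range fun t : G => b (t * g))).topologicalClosure := by
    rw [hrange, b.dense_span]
  set b' : HilbertBasis G ℂ H := HilbertBasis.mk (b.orthonormal.comp _ hinj) hdense with hb'
  refine ⟨((b.repr.trans b'.repr.symm).toContinuousLinearEquiv : H →L[ℂ] H), fun t => ?_⟩
  classical
  have h1 : b'.repr.symm (b.repr (b t)) = b' t := by rw [b.repr_self, b'.repr_symm_single]
  have h2 : b' t = b (t * g) := by rw [hb', HilbertBasis.coe_mk]; rfl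
  exact h1.trans h2

variable (b : HilbertBasis G ℂ H) (lam : G → H →L[ℂ] H)

lemma groupVN_comm_right (hlam : ∀ g t : G, lam g (b t) = b (g * t)) {x : H →L[ℂ] H}
    (hx : x ∈ groupVN lam) {g : G} {R : H →L[ℂ] H} (hR : ∀ t, R (b t) = b (t * g)) (v : H) :
    R (x v) = x (R v) := by
  have hRc : R ∈ Set.centralizer (range lam) := by
    rintro _ ⟨k, rfl⟩
    exact b.clm_ext fun t => by simp [hlam, hR, mul_assoc]
  exact congrArg (fun T : H →L[ℂ] H => T v) (hx R hRc)

variable [CompleteSpace H]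

lemma inner_right_invariant (hlam : ∀ g t : G, lam g (b t) = b (g * t)) {x : H →L[ℂ] H}
    (hx : x ∈ groupVN lam) (s t : G) :
    ⟪b s, x (b t)⟫_ℂ = ⟪b (s * t⁻¹), x (b 1)⟫_ℂ := by
  obtain ⟨R, hR⟩ := exists_right_translation b t
  have hadj : adjoint R (b s) = b (s * t⁻¹) := by
    classical
    apply b.repr.injective
    ext u
    rw [b.repr_apply_apply, b.repr_apply_apply, ContinuousLinearMap.adjoint_inner_right, hR,
      orthonormal_iff_ite.mp b.orthonormal, orthonormal_iff_ite.mp b.orthonormal]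
    simp only [eq_mul_inv_iff_mul_eq]
  have : b t = R (b 1) := by rw [hR, one_mul]
  rw [this, ← groupVN_comm_right b lam hlam hx hR, ← ContinuousLinearMap.adjoint_inner_left, hadj]

/-- The canonical trace on `L(G)` is tracial. -/
lemma tau0_mul_comm (hlam : ∀ g t : G, lam g (b t) = b (g * t)) {x y : H →L[ℂ] H}
    (hx : x ∈ groupVN lam) (hy : y ∈ groupVN lam) : tau0 b (x * y) = tau0 b (y * x) := by
  have key : ∀ {x y : H →L[ℂ] H}, x ∈ groupVN lam → y ∈ groupVN lam →
      tau0 b (x * y) = ∑' g : G, ⟪b g⁻¹, x (b 1)⟫_ℂ * ⟪b g, y (b 1)⟫_ℂ := by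
    intro x y hx _
    simp only [tau0, mul_apply_eq_comp]
    rw [← ContinuousLinearMap.adjoint_inner_left, ← b.tsum_inner_mul_inner]
    congr 1
    ext g
    rw [ContinuousLinearMap.adjoint_inner_left, inner_right_invariant b lam hlam hx, one_mul]
  rw [key hx hy, key hy hx, ← (Equiv.inv G).tsum_eq]
  congr 1
  ext g
  simp [mul_comm]

/-- An element of `L(G)` with only its Fourier coefficient at `1` nonzero is a scalar. -/
lemma eq_smul_one_of_coeff (hlam : ∀ g t : G, lam g (b t) = b (g * t)) {x : H →L[ℂ] H}
    (hx : x ∈ groupVN lam) (h : ∀ g : G, g ≠ 1 → ⟪b g, x (b 1)⟫_ℂ = 0) :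
    x = tau0 b x • (1 : H →L[ℂ] H) := by
  classical
  refine b.clm_ext fun t => b.repr.injective ?_
  ext s
  rw [b.repr_apply_apply, inner_right_invariant b lam hlam hx, b.repr_apply_apply,
    _root_.smul_apply, inner_smul_right, one_apply_eq_self,
    orthonormal_iff_ite.mp b.orthonormal]
  by_cases hst : s = t
  · subst hst; simp [tau0]
  · rw [h _ (by rwa [ne_eq, mul_inv_eq_one])]
    simp [hst]

end Operators

section States

variable {H : Type*} [NormedAddCommGroup H] [InnerProductSpace ℂ H] [CompleteSpace H]

/-- A state on `B(H)`, as an element of the product space `B(H) → ℂ`. -/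
structure IsStateFun (φ : (H →L[ℂ] H) → ℂ) : Prop where
  add : ∀ S T, φ (S + T) = φ S + φ T
  smul : ∀ (c : ℂ) T, φ (c • T) = c * φ T
  one : φ 1 = 1
  nonneg : ∀ T, 0 ≤ φ (star T * T)
  norm_le : ∀ T, ‖φ T‖ ≤ ‖T‖

lemma isClosed_setOf_isStateFun : IsClosed {φ : (H →L[ℂ] H) → ℂ | IsStateFun φ} := by
  have : {φ : (H →L[ℂ] H) → ℂ | IsStateFun φ} =
      (⋂ (S : H →L[ℂ] H) (T : H →L[ℂ] H), {φ | φ (S + T) = φ S + φ T}) ∩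
      (⋂ (c : ℂ) (T : H →L[ℂ] H), {φ | φ (c • T) = c * φ T}) ∩ {φ | φ 1 = 1} ∩
      (⋂ T : H →L[ℂ] H, {φ | 0 ≤ φ (star T * T)}) ∩ ⋂ T : H →L[ℂ] H, {φ | ‖φ T‖ ≤ ‖T‖} := by
    ext φ
    simp only [mem_inter_iff, mem_iInter, mem_ofPred_eq]
    exact ⟨fun h => ⟨⟨⟨⟨h.1, h.2⟩, h.3⟩, h.4⟩, h.5⟩,
      fun h => ⟨h.1.1.1.1, h.1.1.1.2, h.1.1.2, h.1.2, h.2⟩⟩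
  rw [this]
  refine (((IsClosed.inter ?_ ?_).inter ?_).inter ?_).inter ?_
  · exact isClosed_iInter fun S => isClosed_iInter fun T =>
      isClosed_eq (continuous_apply _) (by fun_prop)
  · exact isClosed_iInter fun c => isClosed_iInter fun T =>
      isClosed_eq (continuous_apply _) (by fun_prop)
  · exact isClosed_eq (continuous_apply _) continuous_const
  · exact isClosed_iInter fun T => isClosed_le continuous_const (continuous_apply _)
  · exact isClosed_iInter fun T => isClosed_le (by fun_prop) continuous_const

lemma isCompact_setOf_isStateFun : IsCompact {φ : (H →L[ℂ] H) → ℂ | IsStateFun φ} := by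
  refine (isCompact_univ_pi fun T : H →L[ℂ] H =>
    isCompact_closedBall (0 : ℂ) ‖T‖).of_isClosed_subset isClosed_setOf_isStateFun ?_
  intro φ hφ T _
  simpa using hφ.norm_le T

lemma convex_setOf_isStateFun : Convex ℝ {φ : (H →L[ℂ] H) → ℂ | IsStateFun φ} := by
  intro φ hφ ψ hψ a c ha hc hac
  exact
    { add := fun S T => by
        simp only [Pi.add_apply, Pi.smul_apply, Complex.real_smul, hφ.add, hψ.add]; ring
      smul := fun r T => by
        simp only [Pi.add_apply, Pi.smul_apply, Complex.real_smul, hφ.smul, hψ.smul]; ring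
      one := by
        simp only [Pi.add_apply, Pi.smul_apply, Complex.real_smul, hφ.one, hψ.one, mul_one]
        exact_mod_cast hac
      nonneg := fun T => by
        simp only [Pi.add_apply, Pi.smul_apply, Complex.real_smul]
        exact add_nonneg (mul_nonneg (by exact_mod_cast ha) (hφ.nonneg T))
          (mul_nonneg (by exact_mod_cast hc) (hψ.nonneg T))
      norm_le := fun T => by
        simp only [Pi.add_apply, Pi.smul_apply]
        calc ‖a • φ T + c • ψ T‖ ≤ ‖a • φ T‖ + ‖c • ψ T‖ := norm_add_le _ _
          _ = a * ‖φ T‖ + c * ‖ψ T‖ := by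
            rw [norm_smul, norm_smul, Real.norm_of_nonneg ha, Real.norm_of_nonneg hc]
          _ ≤ a * ‖T‖ + c * ‖T‖ := by
            gcongr
            · exact hφ.norm_le T
            · exact hψ.norm_le T
          _ = ‖T‖ := by rw [← add_mul, hac, one_mul] }

lemma isStateFun_vector {v : H} (hv : ‖v‖ = 1) : IsStateFun fun T : H →L[ℂ] H => ⟪v, T v⟫_ℂ where
  add S T := by simp
  smul c T := by simp
  one := by simp [hv]
  nonneg T := by
    rw [ContinuousLinearMap.star_eq_adjoint, mul_apply_eq_comp,
      ContinuousLinearMap.adjoint_inner_right, inner_self_eq_norm_sq_to_K]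
    simp only [Complex.coe_algebraMap]
    exact_mod_cast sq_nonneg ‖T v‖
  norm_le T := by
    calc ‖⟪v, T v⟫_ℂ‖ ≤ ‖v‖ * ‖T v‖ := norm_inner_le_norm _ _
      _ ≤ ‖v‖ * (‖T‖ * ‖v‖) := by gcongr; exact T.le_opNorm v
      _ = ‖T‖ := by rw [hv]; ring

namespace IsStateFun

variable {φ : (H →L[ℂ] H) → ℂ} (hφ : IsStateFun φ)
include hφ

lemma conj_unitary {u : H →L[ℂ] H} (hu : u ∈ unitary (H →L[ℂ] H)) :
    IsStateFun fun T => φ (u * T * star u) where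
  add S T := by rw [mul_add, add_mul, hφ.add]
  smul c T := by rw [mul_smul_comm, smul_mul_assoc, hφ.smul]
  one := by rw [mul_one, (Unitary.mem_iff.mp hu).2, hφ.one]
  nonneg T := by
    have : u * (star T * T) * star u = star (T * star u) * (T * star u) := by
      simp [mul_assoc]
    rw [this]
    exact hφ.nonneg _
  norm_le T := by
    refine (hφ.norm_le _).trans ?_
    rw [CStarRing.norm_mul_mem_unitary _ (Unitary.star_mem hu), CStarRing.norm_mem_unitary_mul _ hu]

/-- The equality case of the Cauchy–Schwarz inequality at a null vector. -/
lemma mul_eq_zero_of_null {d : H →L[ℂ] H} (hd : φ (star d * d) = 0) (x : H →L[ℂ] H) :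
    φ (star x * d) = 0 ∧ φ (star d * x) = 0 := by
  have key : ∀ t : ℂ,
      0 ≤ φ (star x * x) + t * φ (star x * d) + star t * φ (star d * x) := by
    intro t
    have h := hφ.nonneg (x + t • d)
    have e : star (x + t • d) * (x + t • d)
        = star x * x + t • (star x * d) + star t • (star d * x) +
          (star t * t) • (star d * d) := by
      simp only [star_add, star_smul, add_mul, mul_add, smul_mul_assoc, mul_smul_comm]
      module
    rw [e, hφ.add, hφ.add, hφ.add, hφ.smul, hφ.smul, hφ.smul, hd, mul_zero, add_zero] at h
    exact h
  set α := φ (star x * x)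
  set β := φ (star x * d)
  set γ := φ (star d * x)
  have lin : ∀ δ : ℂ, (∀ r : ℝ, 0 ≤ α + r * δ) → δ = 0 := by
    intro δ h
    have hre : ∀ r : ℝ, 0 ≤ α.re + r * δ.re := fun r => by
      simpa using (Complex.le_def.mp (h r)).1
    have him : ∀ r : ℝ, 0 = α.im + r * δ.im := fun r => by
      simpa using (Complex.le_def.mp (h r)).2
    have h1 : δ.im = 0 := by linarith [him 0, him 1]
    have h2 : δ.re = 0 := by
      by_contra hne
      have := hre (-(α.re + 1) / δ.re)
      rw [div_mul_cancel₀ _ hne] at this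
      linarith
    exact Complex.ext h2 h1
  have h1 : β + γ = 0 := lin _ fun r => by
    have := key r
    simp only [Complex.star_def, Complex.conj_ofReal] at this
    rwa [mul_add, ← add_assoc]
  have h2 : Complex.I * β - Complex.I * γ = 0 := lin _ fun r => by
    have := key (r * Complex.I)
    simp only [Complex.star_def, map_mul, Complex.conj_ofReal, Complex.conj_I] at this
    convert this using 1
    ring
  have h3 : β - γ = 0 := by
    rw [← mul_sub] at h2
    exact (mul_eq_zero.mp h2).resolve_left Complex.I_ne_zero
  constructor
  · linear_combination (h1 + h3) / 2
  · linear_combination (h1 - h3) / 2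

variable {G : Type*} (b : HilbertBasis G ℂ H)

lemma diagOp_nonneg {f : BoundedReal G} (hf : ∀ t, 0 ≤ f t) : 0 ≤ φ (diagOp b f) := by
  set k : BoundedReal G := .ofBound (fun t => √(f t)) (√‖f‖) fun t => by
    rw [abs_of_nonneg (Real.sqrt_nonneg _)]
    exact Real.sqrt_le_sqrt ((le_abs_self _).trans (BoundedReal.abs_apply_le f t)) with hk
  have hkk : f = k * k := by
    ext t
    exact (Real.mul_self_sqrt (hf t)).symm
  have := hφ.nonneg (diagOp b k)
  rwa [star_diagOp, ← diagOp_mul, ← hkk] at this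

/-- The restriction of a state to the diagonal operators is a mean. -/
lemma isMean_diagOp : IsMean fun f : BoundedReal G => (φ (diagOp b f)).re where
  add f h := by rw [diagOp_add, hφ.add, Complex.add_re]
  smul c f := by rw [diagOp_smul, hφ.smul, Complex.re_ofReal_mul]
  one := by rw [diagOp_one, hφ.one, Complex.one_re]
  nonneg f hf := (Complex.le_def.mp (hφ.diagOp_nonneg b hf)).1

/-- A state that is multiplicative at a diagonal operator has it in its multiplicative domain. -/
lemma mul_diagOp {f : BoundedReal G} {c : ℝ} (h1 : (φ (diagOp b f)).re = c)
    (h2 : (φ (diagOp b (f * f))).re = c * c) (x : H →L[ℂ] H) :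
    φ (x * diagOp b f) = c * φ x ∧ φ (diagOp b f * x) = c * φ x := by
  have hm := hφ.isMean_diagOp b
  set d : BoundedReal G := f - c • 1 with hd
  have hdd : d * d = f * f - (2 * c) • f + (c * c) • 1 := by
    ext t
    simp only [hd, BoundedReal.mul_apply, BoundedReal.sub_apply, BoundedReal.add_apply,
      BoundedReal.smul_apply, BoundedReal.one_apply]
    ring
  have hnull : φ (star (diagOp b d) * diagOp b d) = 0 := by
    have hre : (φ (diagOp b (d * d))).re = 0 := by
      have := hm.add (f * f - (2 * c) • f) ((c * c) • 1)
      rw [hm.sub, hm.smul, hm.smul, hm.one, ← hdd] at this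
      rw [this, h1, h2]
      ring
    rw [star_diagOp, ← diagOp_mul]
    have hpos := Complex.le_def.mp (hφ.diagOp_nonneg b (f := d * d) fun t => mul_self_nonneg _)
    exact Complex.ext hre hpos.2.symm
  have hf : diagOp b f = diagOp b d + (c : ℂ) • 1 := by
    rw [← diagOp_one b, ← diagOp_smul, ← diagOp_add, hd, sub_add_cancel]
  constructor
  · have h := (hφ.mul_eq_zero_of_null hnull (star x)).1
    rw [star_star] at h
    rw [hf, mul_add, hφ.add, h, zero_add, mul_smul_comm, hφ.smul, mul_one]
  · have h := (hφ.mul_eq_zero_of_null hnull x).2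
    rw [star_diagOp] at h
    rw [hf, add_mul, hφ.add, h, zero_add, smul_mul_assoc, hφ.smul, one_mul]

/-- A state invariant under the unitaries of a relative commutant is central on it. -/
lemma mul_comm_of_unitary_invariant {S : Set (H →L[ℂ] H)}
    (hinv : ∀ u ∈ unitary (H →L[ℂ] H), u ∈ StarSubalgebra.centralizer ℂ S →
      ∀ x, φ (u * x * star u) = φ x)
    {z : H →L[ℂ] H} (hz : z ∈ StarSubalgebra.centralizer ℂ S) (x : H →L[ℂ] H) :
    φ (z * x) = φ (x * z) := by
  have hunit : ∀ u ∈ unitary (H →L[ℂ] H), u ∈ StarSubalgebra.centralizer ℂ S →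
      ∀ x, φ (u * x) = φ (x * u) := by
    intro u hu huS x
    have := hinv u hu huS (x * u)
    rwa [mul_assoc, mul_assoc, (Unitary.mem_iff.mp hu).2, mul_one] at this
  have hsmall : ∀ a : H →L[ℂ] H, IsSelfAdjoint a → ‖a‖ ≤ 1 →
      a ∈ StarSubalgebra.centralizer ℂ S → ∀ x, φ (a * x) = φ (x * a) := by
    intro a ha hnorm haS x
    set s := CFC.sqrt (1 - a ^ 2) with hs
    have hsS : s ∈ StarSubalgebra.centralizer ℂ S := by
      have hcomm : ∀ g, g * a = a * g → g * s = s * g := by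
        intro g hg
        have h1 : Commute (1 - a ^ 2) g :=
          (Commute.one_left g).sub_left (Commute.pow_left (show Commute a g from hg.symm) 2)
        exact (h1.cfcₙ_nnreal NNReal.sqrt).symm
      rw [StarSubalgebra.mem_centralizer_iff] at haS ⊢
      exact fun g hg => ⟨hcomm g (haS g hg).1, hcomm (star g) (haS g hg).2⟩
    have hsa : IsSelfAdjoint s := (CFC.sqrt_nonneg (1 - a ^ 2)).isSelfAdjoint
    have hu := ha.self_add_I_smul_cfcSqrt_sub_sq_mem_unitary a hnorm
    have huS : a + Complex.I • s ∈ StarSubalgebra.centralizer ℂ S :=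
      add_mem haS (SMulMemClass.smul_mem _ hsS)
    have e1 := hunit _ hu huS x
    have e2 := hunit _ (Unitary.star_mem hu) (star_mem huS) x
    have hstar : star (a + Complex.I • s) = a + (-Complex.I) • s := by
      rw [star_add, star_smul, ha.star_eq, hsa.star_eq]
      simp
    rw [← hs, hstar] at e2
    rw [add_mul, mul_add, smul_mul_assoc, mul_smul_comm, hφ.add, hφ.add, hφ.smul, hφ.smul] at e1 e2
    linear_combination (e1 + e2) / 2
  have hself : ∀ a : H →L[ℂ] H, IsSelfAdjoint a →
      a ∈ StarSubalgebra.centralizer ℂ S → ∀ x, φ (a * x) = φ (x * a) := by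
    intro a ha haS x
    set r : ℝ := ‖a‖ + 1
    have hr : 0 < r := by positivity
    have hrc : (r : ℂ) ≠ 0 := by exact_mod_cast hr.ne'
    have h := hsmall (((r⁻¹ : ℝ) : ℂ) • a) (by
        rw [isSelfAdjoint_iff, star_smul, ha.star_eq]
        simp) (by
        rw [norm_smul, Complex.norm_real, Real.norm_of_nonneg (inv_nonneg.mpr hr.le),
          inv_mul_le_iff₀ hr]
        simp [r]) (SMulMemClass.smul_mem _ haS) x
    rw [smul_mul_assoc, mul_smul_comm, hφ.smul, hφ.smul] at h
    exact mul_left_cancel₀ (by simpa using hr.ne') h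
  have hre := hself (realPart z : H →L[ℂ] H) (realPart z).2 (by
    rw [realPart_apply_coe]
    have := add_mem hz (star_mem hz)
    have h2 := SMulMemClass.smul_mem ((2⁻¹ : ℝ) : ℂ) this
    exact h2) x
  have him := hself (imaginaryPart z : H →L[ℂ] H) (imaginaryPart z).2 (by
    rw [imaginaryPart_apply_coe]
    have := sub_mem hz (star_mem hz)
    have h2 := SMulMemClass.smul_mem (-Complex.I) (SMulMemClass.smul_mem ((2⁻¹ : ℝ) : ℂ) this)
    exact h2) x
  rw [← realPart_add_I_smul_imaginaryPart z, add_mul, mul_add, smul_mul_assoc, mul_smul_comm,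
    hφ.add, hφ.add, hφ.smul, hφ.smul, hre, him]

end IsStateFun

end States

section Amenable

variable {G : Type*} [Group G]

/-- The subgroup of elements whose translation fixes every mean in a set of means. -/
def fixingSubgroupOfMeans (C : Set (BoundedReal G → ℝ)) : Subgroup G where
  carrier := {g | ∀ ω ∈ C, ∀ f, ω (leftTranslate g f) = ω f}
  one_mem' ω _ f := by rw [leftTranslate_one]
  mul_mem' {g h} hg hh ω hω f := by rw [leftTranslate_mul, hg ω hω, hh ω hω]
  inv_mem' {g} hg ω hω f := by
    rw [← hg ω hω, ← leftTranslate_mul, mul_inv_cancel, leftTranslate_one]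

lemma fixingSubgroupOfMeans_normal {C : Set (BoundedReal G → ℝ)}
    (hinv : ∀ ω ∈ C, ∀ g, (fun f => ω (leftTranslate g f)) ∈ C) :
    (fixingSubgroupOfMeans C).Normal where
  conj_mem n hn g ω hω f := by
    rw [leftTranslate_mul, leftTranslate_mul]
    have := hn _ (hinv ω hω g) (leftTranslate g⁻¹ f)
    rw [this, ← leftTranslate_mul, mul_inv_cancel, leftTranslate_one]

/-- A normal subgroup fixing a mean on the ambient group is amenable. -/
lemma hasInvariantMean_of_fixes_mean (N : Subgroup G) [N.Normal] {ω : BoundedReal G → ℝ}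
    (hω : IsMean ω) (hfix : ∀ g ∈ N, ∀ f, ω (leftTranslate g f) = ω f) : HasInvariantMean N := by
  have hmem : ∀ s : G, s * ((s : G ⧸ N).out)⁻¹ ∈ N := fun s => by
    rw [← QuotientGroup.eq_one_iff, QuotientGroup.mk_mul, QuotientGroup.mk_inv,
      QuotientGroup.out_eq', mul_inv_cancel]
  set p : G → N := fun s => ⟨s * ((s : G ⧸ N).out)⁻¹, hmem s⟩ with hp
  have hpmul : ∀ (k : N) (s : G), p (k * s) = k * p s := by
    intro k s
    have : ((k * s : G) : G ⧸ N) = s := by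
      rw [QuotientGroup.mk_mul, (QuotientGroup.eq_one_iff _).mpr k.2, one_mul]
    ext
    simp [hp, this, mul_assoc]
  have hbound : ∀ (f : lp (fun _ : N => ℂ) ∞) (x : N), ‖f x‖ ≤ ‖f‖ := fun f x =>
    lp.norm_apply_le_norm ENNReal.top_ne_zero f x
  set re : lp (fun _ : N => ℂ) ∞ → BoundedReal G := fun f =>
    .ofBound (fun s => (f (p s)).re) ‖f‖ fun s => (Complex.abs_re_le_norm _).trans (hbound f _)
    with hre
  set im : lp (fun _ : N => ℂ) ∞ → BoundedReal G := fun f =>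
    .ofBound (fun s => (f (p s)).im) ‖f‖ fun s => (Complex.abs_im_le_norm _).trans (hbound f _)
    with him
  refine ⟨{ toFun := fun f => (ω (re f) : ℂ) + ω (im f) * Complex.I
            map_add' := fun f h => ?_
            map_smul' := fun c f => ?_ }, ?_, fun f => ?_, fun g f₁ f₂ hf => ?_⟩
  · have h1 : re (f + h) = re f + re h := by ext s; rfl
    have h2 : im (f + h) = im f + im h := by ext s; rfl
    rw [h1, h2, hω.add, hω.add]
    push_cast
    ring
  · have h1 : re (c • f) = c.re • re f - c.im • im f := by
      ext s; exact Complex.mul_re c (f (p s))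
    have h2 : im (c • f) = c.re • im f + c.im • re f := by
      ext s; exact Complex.mul_im c (f (p s))
    rw [h1, h2, hω.sub, hω.add, hω.smul, hω.smul, hω.smul, hω.smul]
    simp only [RingHom.id_apply, smul_eq_mul]
    apply Complex.ext <;> simp
  · have h1 : re 1 = 1 := by ext s; rfl
    have h2 : im 1 = (0 : ℝ) • 1 := by ext s; simp [him, BoundedReal.ofBound]
    simp only [LinearMap.coe_mk, AddHom.coe_mk, h1, h2, hω.smul, hω.one]
    simp
  · have h2 : im (star f * f) = (0 : ℝ) • 1 := by
      ext s
      have : (starRingEnd ℂ (f (p s)) * f (p s)).im = 0 := by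
        rw [← Complex.normSq_eq_conj_mul_self]; exact Complex.ofReal_im _
      rw [BoundedReal.smul_apply, zero_mul]
      exact this
    have h1 : 0 ≤ ω (re (star f * f)) := hω.nonneg _ fun s => by
      have : 0 ≤ (starRingEnd ℂ (f (p s)) * f (p s)).re := by
        rw [← Complex.normSq_eq_conj_mul_self, Complex.ofReal_re]; exact Complex.normSq_nonneg _
      exact this
    simp only [LinearMap.coe_mk, AddHom.coe_mk, h2, hω.smul]
    simpa using h1
  · have h1 : re f₂ = leftTranslate (g : G)⁻¹ (re f₁) := by
      ext s
      simp only [hre, leftTranslate_apply, BoundedReal.ofBound, inv_inv, hpmul, hf]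
    have h2 : im f₂ = leftTranslate (g : G)⁻¹ (im f₁) := by
      ext s
      simp only [him, leftTranslate_apply, BoundedReal.ofBound, inv_inv, hpmul, hf]
    simp only [LinearMap.coe_mk, AddHom.coe_mk, h1, h2, hfix _ (inv_mem g.2)]

end Amenable

section Hypertraces

variable {G : Type*} [Group G] {H : Type*} [NormedAddCommGroup H] [InnerProductSpace ℂ H]
  [CompleteSpace H]

/-- The states on `B(H)` extending the trace of `L(G)` and invariant under the unitaries in `Z`. -/
def invariantStates (b : HilbertBasis G ℂ H) (lam : G → H →L[ℂ] H)
    (Z : StarSubalgebra ℂ (H →L[ℂ] H)) : Set ((H →L[ℂ] H) → ℂ) :=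
  {φ | IsStateFun φ ∧ (∀ x ∈ groupVN lam, φ x = tau0 b x) ∧
    ∀ u ∈ unitary (H →L[ℂ] H), u ∈ Z → ∀ x, φ (u * x * star u) = φ x}

variable (b : HilbertBasis G ℂ H) (lam : G → H →L[ℂ] H)

/-- The states on `B(H)` extending the trace of `L(G)`. -/
def traceStates : Set ((H →L[ℂ] H) → ℂ) :=
  {φ | IsStateFun φ} ∩ ⋂ x ∈ groupVN lam, {φ | φ x = tau0 b x}

lemma isCompact_traceStates : IsCompact (traceStates b lam) :=
  isCompact_setOf_isStateFun.inter_right <| isClosed_iInter fun _ => isClosed_iInter fun _ =>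
    isClosed_eq (continuous_apply _) continuous_const

lemma convex_traceStates : Convex ℝ (traceStates b lam) := by
  refine convex_setOf_isStateFun.inter (convex_iInter₂ fun x _ => ?_)
  intro φ hφ ψ hψ a c _ _ hac
  simp only [mem_ofPred_eq] at hφ hψ ⊢
  rw [Pi.add_apply, Pi.smul_apply, Pi.smul_apply, hφ, hψ, ← add_smul, hac, one_smul]

lemma invariantStates_eq (Z : StarSubalgebra ℂ (H →L[ℂ] H)) :
    invariantStates b lam Z = traceStates b lam ∩
      ⋂ (u ∈ unitary (H →L[ℂ] H)) (_ : u ∈ Z) (x : H →L[ℂ] H),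
        {φ | φ (u * x * star u) = φ x} := by
  ext φ
  simp only [invariantStates, traceStates, mem_inter_iff, mem_iInter, mem_ofPred_eq, and_assoc]

lemma isCompact_invariantStates (Z : StarSubalgebra ℂ (H →L[ℂ] H)) :
    IsCompact (invariantStates b lam Z) := by
  rw [invariantStates_eq]
  exact (isCompact_traceStates b lam).inter_right <| isClosed_iInter fun _ =>
    isClosed_iInter fun _ => isClosed_iInter fun _ => isClosed_iInter fun _ =>
      isClosed_eq (continuous_apply _) (continuous_apply _)

lemma convex_invariantStates (Z : StarSubalgebra ℂ (H →L[ℂ] H)) :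
    Convex ℝ (invariantStates b lam Z) := by
  rw [invariantStates_eq]
  refine (convex_traceStates b lam).inter (convex_iInter₂ fun u _ => convex_iInter₂ fun _ x => ?_)
  intro φ hφ ψ hψ a c _ _ _
  simp only [mem_ofPred_eq] at hφ hψ ⊢
  rw [Pi.add_apply, Pi.smul_apply, Pi.smul_apply, hφ, hψ]
  rfl

/-- Conjugating by a unitary of `L(G)` preserves the states extending the trace. -/
lemma conj_mem_traceStates (hlam : ∀ g t : G, lam g (b t) = b (g * t)) {u : H →L[ℂ] H}
    (hu : u ∈ unitary (H →L[ℂ] H)) (huL : u ∈ groupVN lam) (huL' : star u ∈ groupVN lam)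
    {φ : (H →L[ℂ] H) → ℂ} (hφ : φ ∈ traceStates b lam) :
    (fun x => φ (u * x * star u)) ∈ traceStates b lam := by
  simp only [traceStates, mem_inter_iff, mem_iInter, mem_ofPred_eq] at hφ ⊢
  refine ⟨hφ.1.conj_unitary hu, fun x hx => ?_⟩
  rw [hφ.2 _ (Set.mul_mem_centralizer (Set.mul_mem_centralizer huL hx) huL'), mul_assoc,
    tau0_mul_comm b lam hlam huL (Set.mul_mem_centralizer hx huL'), mul_assoc,
    (Unitary.mem_iff.mp hu).1, mul_one]

/-- A commutative star subalgebra of `L(G)` has an invariant state extending the trace. -/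
lemma invariantStates_nonempty (hlam : ∀ g t : G, lam g (b t) = b (g * t))
    (Z : StarSubalgebra ℂ (H →L[ℂ] H)) (hZ : (Z : Set (H →L[ℂ] H)) ⊆ groupVN lam)
    (hcomm : ∀ z ∈ Z, ∀ w ∈ Z, z * w = w * z) : (invariantStates b lam Z).Nonempty := by
  let T : (H →L[ℂ] H) → (((H →L[ℂ] H) → ℂ) →L[ℝ] ((H →L[ℂ] H) → ℂ)) := fun u =>
    ContinuousLinearMap.pi fun x => ContinuousLinearMap.proj (u * x * star u)
  have hT : ∀ u φ x, T u φ x = φ (u * x * star u) := fun _ _ _ => rfl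
  obtain ⟨φ, hφ, hfix⟩ := exists_common_fixedPoint (isCompact_traceStates b lam)
    (convex_traceStates b lam)
    ⟨fun x => ⟪b 1, x (b 1)⟫_ℂ, by
      simp only [traceStates, mem_inter_iff, mem_iInter, mem_ofPred_eq]
      exact ⟨isStateFun_vector (b.orthonormal.1 1), fun x _ => rfl⟩⟩
    {S | ∃ u ∈ unitary (H →L[ℂ] H), u ∈ Z ∧ S = T u}
    (by
      rintro _ ⟨u, hu, huZ, rfl⟩ φ hφ
      exact conj_mem_traceStates b lam hlam hu (hZ huZ) (hZ (star_mem huZ)) hφ)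
    (by
      rintro _ ⟨u, hu, huZ, rfl⟩ _ ⟨v, hv, hvZ, rfl⟩ φ
      ext x
      simp only [hT]
      congr 1
      calc v * (u * x * star u) * star v = (v * u) * x * star (v * u) := by
            simp only [star_mul, mul_assoc]
        _ = (u * v) * x * star (u * v) := by rw [hcomm v hvZ u huZ]
        _ = u * (v * x * star v) * star u := by simp only [star_mul, mul_assoc])
  rw [invariantStates_eq]
  refine ⟨φ, hφ, ?_⟩
  simp only [mem_iInter, mem_ofPred_eq]
  intro u hu huZ x
  exact congrFun (hfix _ ⟨u, hu, huZ, rfl⟩) x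

end Hypertraces

section InvariantSubalgebras

variable {G : Type*} [Group G] {H : Type*} [NormedAddCommGroup H] [InnerProductSpace ℂ H]
  [CompleteSpace H] (b : HilbertBasis G ℂ H) (lam : G → H →L[ℂ] H)

lemma lam_mem_groupVN {G H : Type*} [NormedAddCommGroup H] [InnerProductSpace ℂ H]
    (lam : G → H →L[ℂ] H) (g : G) : lam g ∈ groupVN lam :=
  Set.subset_centralizer_centralizer ⟨g, rfl⟩

lemma lam_mem_unitary (hlam : ∀ g t : G, lam g (b t) = b (g * t))
    (hadj : ∀ g : G, adjoint (lam g) = lam g⁻¹) (g : G) : lam g ∈ unitary (H →L[ℂ] H) := by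
  rw [Unitary.mem_iff, ContinuousLinearMap.star_eq_adjoint, hadj]
  exact ⟨b.clm_ext fun t => by simp [hlam], b.clm_ext fun t => by simp [hlam]⟩

/-- The invariant states are permuted by conjugation with the regular representation. -/
lemma conj_lam_mem_invariantStates (hlam : ∀ g t : G, lam g (b t) = b (g * t))
    (hadj : ∀ g : G, adjoint (lam g) = lam g⁻¹) (Z : StarSubalgebra ℂ (H →L[ℂ] H))
    (hconj : ∀ g : G, ∀ z ∈ Z, lam g * z * star (lam g) ∈ Z) (g : G)
    {φ : (H →L[ℂ] H) → ℂ} (hφ : φ ∈ invariantStates b lam Z) :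
    (fun x => φ (lam g * x * star (lam g))) ∈ invariantStates b lam Z := by
  have hU := lam_mem_unitary b lam hlam hadj g
  have hstar : star (lam g) ∈ groupVN lam := by
    rw [ContinuousLinearMap.star_eq_adjoint, hadj]
    exact lam_mem_groupVN lam _
  have hinv := hφ.2.2
  rw [invariantStates_eq] at hφ ⊢
  refine ⟨conj_mem_traceStates b lam hlam hU (lam_mem_groupVN lam g) hstar hφ.1, ?_⟩
  simp only [mem_iInter, mem_ofPred_eq]
  intro u hu huZ x
  have h1 : star (lam g) * lam g = 1 := (Unitary.mem_iff.mp hU).1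
  have h1' : ∀ y, star (lam g) * (lam g * y) = y := fun y => by rw [← mul_assoc, h1, one_mul]
  have := hinv (lam g * u * star (lam g))
    (mul_mem (mul_mem hU hu) (Unitary.star_mem hU)) (hconj g u huZ) (lam g * x * star (lam g))
  rw [← this]
  congr 1
  simp only [star_mul, star_star, mul_assoc, h1']

/-- An element of a `G`-invariant abelian subalgebra of `L(G)` is a scalar if `G` has no nontrivial
amenable normal subgroup. -/
theorem exists_eq_smul_one_of_mem_abelian (hlam : ∀ g t : G, lam g (b t) = b (g * t))
    (hadj : ∀ g : G, adjoint (lam g) = lam g⁻¹)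
    (hradical : ∀ N : Subgroup G, N.Normal → HasInvariantMean N → N = ⊥)
    (S : Set (H →L[ℂ] H))
    (hL : (StarSubalgebra.centralizer ℂ S : Set (H →L[ℂ] H)) ⊆ groupVN lam)
    (hcomm : ∀ z ∈ StarSubalgebra.centralizer ℂ S, ∀ w ∈ StarSubalgebra.centralizer ℂ S,
      z * w = w * z)
    (hconj : ∀ g : G, ∀ z ∈ StarSubalgebra.centralizer ℂ S,
      lam g * z * star (lam g) ∈ StarSubalgebra.centralizer ℂ S)
    {z : H →L[ℂ] H} (hz : z ∈ StarSubalgebra.centralizer ℂ S) :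
    ∃ c : ℂ, z = c • (1 : H →L[ℂ] H) := by
  set Z := StarSubalgebra.centralizer ℂ S with hZ
  obtain ⟨C, hCmean, hCc, hCconv, ⟨ω₀, h₀⟩, hCinv, hCmin⟩ := exists_minimal_invariant_convex
    (isCompact_setOf_isMean G) (convex_setOf_isMean G) ⟨_, IsMean.eval 1⟩
    (fun (g : G) (ω : BoundedReal G → ℝ) f => ω (leftTranslate g f))
    fun g ω hω => IsMean.comp_leftTranslate hω g
  have hinv : ∀ ω ∈ C, ∀ g, (fun f => ω (leftTranslate g f)) ∈ C := fun ω hω g => hCinv g hω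
  have hω₀ : IsMean ω₀ := hCmean h₀
  let β : ((H →L[ℂ] H) → ℂ) → BoundedReal G → ℝ := fun φ f => (φ (diagOp b (poisson hω₀ f))).re
  have hlift : β '' invariantStates b lam Z = C := by
    refine hCmin _ ?_ ?_ ?_ ?_ fun g => ?_
    · rintro _ ⟨φ, hφ, rfl⟩
      exact comp_poisson_mem hω₀ hCc.isClosed hCconv hCmean hinv h₀ (hφ.1.isMean_diagOp b)
    · exact (isCompact_invariantStates b lam Z).image <| continuous_pi fun f =>
        Complex.continuous_re.comp (continuous_apply _)
    · rintro _ ⟨φ, hφ, rfl⟩ _ ⟨ψ, hψ, rfl⟩ a c ha hc hac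
      refine ⟨_, convex_invariantStates b lam Z hφ hψ ha hc hac, ?_⟩
      ext f
      simp [β]
    · exact (invariantStates_nonempty b lam hlam Z hL hcomm).image β
    · rintro _ ⟨φ, hφ, rfl⟩
      refine ⟨_, conj_lam_mem_invariantStates b lam hlam hadj Z hconj g hφ, ?_⟩
      ext f
      simp only [β]
      rw [poisson_leftTranslate, lam_mul_diagOp b lam hlam, mul_assoc,
        (Unitary.mem_iff.mp (lam_mem_unitary b lam hlam hadj g)).2, mul_one]
  have hext : ∀ (g : G) (a : H →L[ℂ] H), a ∈ Z → tau0 b (lam g * a) ≠ 0 →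
      ∀ ω ∈ C.extremePoints ℝ, ∀ f, ω (leftTranslate g f) = ω f := by
    intro g a ha hne ω hω f
    obtain ⟨φ, hφ, hβ⟩ : ω ∈ β '' invariantStates b lam Z := hlift ▸ hω.1
    have hνω : ∀ f, (φ (diagOp b (poisson hω₀ f))).re = ω f := fun f => congrFun hβ f
    have hmult : ∀ f x, φ (x * diagOp b (poisson hω₀ f)) = ω f * φ x ∧
        φ (diagOp b (poisson hω₀ f) * x) = ω f * φ x := fun f x => by
      refine hφ.1.mul_diagOp b (hνω f) ?_ x
      rw [mul_poisson_of_mem_extremePoints hω₀ hCc.isClosed hCconv hCmean hinv h₀ hω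
        (hφ.1.isMean_diagOp b) hνω, hνω]
    have hcentral : ∀ x, φ (a * x) = φ (x * a) := hφ.1.mul_comm_of_unitary_invariant hφ.2.2 ha
    have e1 := (hmult f (a * lam g)).1
    have e2 := (hmult (leftTranslate g f) (lam g * a)).2
    rw [mul_assoc, hcentral, lam_mul_diagOp b lam hlam, ← poisson_leftTranslate, mul_assoc, e2,
      hcentral, hφ.2.1 _ (Set.mul_mem_centralizer (lam_mem_groupVN lam g) (hL ha))] at e1
    exact_mod_cast mul_right_cancel₀ hne e1
  have hfix : ∀ (g : G) (a : H →L[ℂ] H), a ∈ Z → tau0 b (lam g * a) ≠ 0 →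
      g ∈ fixingSubgroupOfMeans C := by
    intro g a ha hne
    have hclosed : IsClosed {ω : BoundedReal G → ℝ | ∀ f, ω (leftTranslate g f) = ω f} := by
      simp only [Set.ofPred_forall]
      exact isClosed_iInter fun f => isClosed_eq (continuous_apply _) (continuous_apply _)
    have hconvex : Convex ℝ {ω : BoundedReal G → ℝ | ∀ f, ω (leftTranslate g f) = ω f} := by
      intro ω hω ν hν s t _ _ _ f
      simp only [Pi.add_apply, Pi.smul_apply, hω f, hν f]
    intro ω hω
    rw [← closure_convexHull_extremePoints hCc hCconv] at hω
    exact closure_minimal (convexHull_min (fun ν hν => hext g a ha hne ν hν) hconvex) hclosed hω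
  have hbot : fixingSubgroupOfMeans C = ⊥ := by
    have hnormal := fixingSubgroupOfMeans_normal hinv
    exact hradical _ hnormal (hasInvariantMean_of_fixes_mean _ hω₀ fun g hg => hg ω₀ h₀)
  refine ⟨_, eq_smul_one_of_coeff b lam hlam (hL hz) fun g hg => ?_⟩
  by_contra hne
  have hcoeff : tau0 b (lam g⁻¹ * z) = ⟪b g, z (b 1)⟫_ℂ := by
    rw [tau0, ← hadj, mul_apply_eq_comp, ContinuousLinearMap.adjoint_inner_right, hlam, mul_one]
  have := hfix g⁻¹ z hz (hcoeff ▸ hne)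
  rw [hbot, Subgroup.mem_bot, inv_eq_one] at this
  exact hg this

end InvariantSubalgebras

/-- If the amenable radical of `Γ` is trivial (every amenable normal subgroup
is trivial), then every `Γ`-invariant von Neumann subalgebra `M ⊆ L(Γ)` is a factor: every
central element of `M` is a scalar multiple of the identity. -/
theorem invariant_subalgebra_is_factor_of_trivial_radical
    {Γ : Type*} [Group Γ] [Countable Γ]
    {H : Type*} [NormedAddCommGroup H] [InnerProductSpace ℂ H] [CompleteSpace H]
    (b : HilbertBasis Γ ℂ H) (lam : Γ → H →L[ℂ] H)
    (hlam : ∀ g t : Γ, lam g (b t) = b (g * t))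
    (hmul : ∀ g h : Γ, lam (g * h) = lam g * lam h)
    (hadj : ∀ g : Γ, adjoint (lam g) = lam g⁻¹)
    (hradical : ∀ N : Subgroup Γ, N.Normal → HasInvariantMean N → N = ⊥)
    (M : VonNeumannAlgebra H)
    (hM : (M : Set (H →L[ℂ] H)) ⊆ groupVN lam)
    (hInv : ∀ g : Γ, ∀ m ∈ M, lam g * m * adjoint (lam g) ∈ M) :
    ∀ z ∈ M, (∀ m ∈ M, z * m = m * z) → ∃ c : ℂ, z = c • (1 : H →L[ℂ] H) := by
  set S : Set (H →L[ℂ] H) := M ∪ M.commutant with hS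
  have hmem : ∀ z, z ∈ StarSubalgebra.centralizer ℂ S ↔ z ∈ M ∧ ∀ m ∈ M, z * m = m * z := by
    intro z
    rw [StarSubalgebra.mem_centralizer_iff]
    constructor
    · intro h
      refine ⟨?_, fun m hm => (h m (Or.inl hm)).1.symm⟩
      rw [← M.commutant_commutant, VonNeumannAlgebra.mem_commutant_iff]
      exact fun g hg => (h g (Or.inr hg)).1
    · rintro ⟨hz, hc⟩ g (hg | hg)
      · exact ⟨(hc g hg).symm, (hc _ (star_mem (S := VonNeumannAlgebra H) hg)).symm⟩
      · exact ⟨(VonNeumannAlgebra.mem_commutant_iff.mp hg z hz).symm,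
          (VonNeumannAlgebra.mem_commutant_iff.mp
            (star_mem (S := VonNeumannAlgebra H) hg) z hz).symm⟩
  intro z hz hc
  refine exists_eq_smul_one_of_mem_abelian b lam hlam hadj hradical S
    (fun w hw => hM ((hmem w).mp hw).1)
    (fun z hz w hw => ((hmem z).mp hz).2 w ((hmem w).mp hw).1) (fun g w hw => ?_)
    ((hmem z).mpr ⟨hz, hc⟩)
  rw [hmem] at hw ⊢
  rw [ContinuousLinearMap.star_eq_adjoint]
  refine ⟨hInv g w hw.1, fun m hm => ?_⟩
  have hU := Unitary.mem_iff.mp (lam_mem_unitary b lam hlam hadj g)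
  rw [ContinuousLinearMap.star_eq_adjoint] at hU
  have hconj := hw.2 _ (hInv g⁻¹ m hm)
  rw [← hadj, adjoint_adjoint] at hconj
  calc lam g * w * adjoint (lam g) * m
      = lam g * w * adjoint (lam g) * m * (lam g * adjoint (lam g)) := by rw [hU.2, mul_one]
    _ = lam g * (w * (adjoint (lam g) * m * lam g)) * adjoint (lam g) := by
      simp only [mul_assoc]
    _ = lam g * adjoint (lam g) * m * (lam g * w * adjoint (lam g)) := by
      rw [hconj]
      simp only [mul_assoc]
    _ = m * (lam g * w * adjoint (lam g)) := by rw [hU.2, one_mul]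

end
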